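/- arXiv:2505.22384 — 2 statements merged into one kernel-verified Lean document; each statement's English description precedes it below -/
import Mathlib

section
/- In every optimal 𝒞-partition P of the graph G, for each i ∈ Fin k there is a single part of P containing the whole set {u_i} ∪ I_i. -/
open scoped Classical

/-- The coalition-size bound `𝒞 = k(k−1)/2 + k·m + 1`. -/
def cap (k m : ℕ) : ℕ := k * (k - 1) / 2 + k * m + 1

/-- Vertices of the graph `G` built from `H`: the clique vertices
`V^i = {u^i_ℓ, v^i_ℓ}` (encoded as `(i, ℓ, c)` with `c : Bool`), the vertices
`u_i`, the independent sets `I_i`, one vertex `v_e` for each edge `e` of `H`,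
and the apex vertex `x`. -/
abbrev MCVtx (k m : ℕ) (H : SimpleGraph (Fin k × Fin (2 ^ m))) :=
  (Fin k × Fin m × Bool) ⊕ Fin k ⊕ (Fin k × Fin (cap k m - m - 1)) ⊕
    {e : Sym2 (Fin k × Fin (2 ^ m)) // e ∈ H.edgeSet} ⊕ Unit

/-- Base (directed) adjacency relation; the graph is its symmetrization.
The vertex `v_e` is joined to `(i, ℓ, c)` iff `e` has an endpoint `(i, a)`
whose `ℓ`-th binary digit is `c` (this encodes `S_i(a)`). -/
def mcR (k m : ℕ) (H : SimpleGraph (Fin k × Fin (2 ^ m))) :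
    MCVtx k m H → MCVtx k m H → Prop
  | Sum.inl a, Sum.inl b => a.1 = b.1 ∧ a ≠ b
  | Sum.inr (Sum.inl i), Sum.inl b => b.1 = i
  | Sum.inr (Sum.inl i), Sum.inr (Sum.inr (Sum.inl z)) => z.1 = i
  | Sum.inr (Sum.inr (Sum.inr (Sum.inl e))), Sum.inl b =>
      ∃ a : Fin (2 ^ m), (b.1, a) ∈ e.val ∧ a.val.testBit b.2.1.val = b.2.2
  | Sum.inr (Sum.inr (Sum.inr (Sum.inr _))), Sum.inl _ => True
  | Sum.inr (Sum.inr (Sum.inr (Sum.inr _))), Sum.inr (Sum.inr (Sum.inr (Sum.inl _))) => True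
  | _, _ => False

/-- The graph `G` of the construction. -/
def mcGraph (k m : ℕ) (H : SimpleGraph (Fin k × Fin (2 ^ m))) :
    SimpleGraph (MCVtx k m H) where
  Adj a b := mcR k m H a b ∨ mcR k m H b a
  symm := ⟨fun _ _ h => h.symm⟩
  loopless := by
    refine ⟨?_⟩
    intro a h
    rcases h with h | h <;>
      rcases a with a | i | z | e | u <;> simp [mcR] at h

/-- Directed weights; the weight of an unordered pair is obtained by
symmetrizing. Weights: `4𝒞³` between `u_i` and `I_i`, `3𝒞²` between `u_i` and
`V^i`, `2𝒞` between `x` and `V^i`, and `1` everywhere else. -/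
def mcD (k m : ℕ) (H : SimpleGraph (Fin k × Fin (2 ^ m))) :
    MCVtx k m H → MCVtx k m H → ℕ
  | Sum.inr (Sum.inl _), Sum.inr (Sum.inr (Sum.inl _)) => 4 * cap k m ^ 3
  | Sum.inr (Sum.inr (Sum.inl _)), Sum.inr (Sum.inl _) => 4 * cap k m ^ 3
  | Sum.inr (Sum.inl _), Sum.inl _ => 3 * cap k m ^ 2
  | Sum.inl _, Sum.inr (Sum.inl _) => 3 * cap k m ^ 2
  | Sum.inr (Sum.inr (Sum.inr (Sum.inr _))), Sum.inl _ => 2 * cap k m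
  | Sum.inl _, Sum.inr (Sum.inr (Sum.inr (Sum.inr _))) => 2 * cap k m
  | _, _ => 1

/-- The edge-weight function of `G`. -/
def mcW (k m : ℕ) (H : SimpleGraph (Fin k × Fin (2 ^ m))) :
    Sym2 (MCVtx k m H) → ℕ :=
  Sym2.lift ⟨fun a b => mcD k m H a b, by
    intro a b
    rcases a with a | i | z | e | u <;> rcases b with b | j | y | f | v <;> rfl⟩

/-- The weight of the edges of `G` with both endpoints in `Q`. -/
noncomputable def partVal {V : Type*} [DecidableEq V] (G : SimpleGraph V)
    (w : Sym2 V → ℕ) (Q : Finset V) : ℕ :=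
  ∑ e ∈ Q.sym2.filter (fun e => e ∈ G.edgeSet), w e

/-- The value of a partition `P` of the vertex set of `G`. -/
noncomputable def pVal {V : Type*} [Fintype V] [DecidableEq V] (G : SimpleGraph V)
    (w : Sym2 V → ℕ) (P : Finpartition (Finset.univ : Finset V)) : ℕ :=
  ∑ Q ∈ P.parts, partVal G w Q

/-- The value of a partition is the total weight of the edges lying inside some part. -/
theorem pVal_eq_sum_filter {V : Type*} [Fintype V] [DecidableEq V] (G : SimpleGraph V)
    (w : Sym2 V → ℕ) (P : Finpartition (Finset.univ : Finset V)) :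
    pVal G w P =
      ∑ e : Sym2 V with e ∈ G.edgeSet ∧ ∃ Q ∈ P.parts, e ∈ Q.sym2, w e := by
  unfold pVal partVal
  rw [← Finset.sum_biUnion]
  · congr 1
    ext e
    simp only [Finset.mem_biUnion, Finset.mem_filter, Finset.mem_univ, true_and]
    tauto
  · intro Q hQ R hR hQR
    rw [Function.onFun, Finset.disjoint_left]
    intro e he he'
    induction e with
    | _ a b =>
      simp only [Finset.mem_filter, Finset.mk_mem_sym2_iff] at he he'
      exact hQR (P.eq_of_mem_parts hQ hR he.1.1 he'.1.1)

/-- The partition obtained from `P` by making `A` a part and removing `A` from all other parts. -/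
def Finpartition.isolate {V : Type*} [Fintype V] [DecidableEq V]
    (P : Finpartition (Finset.univ : Finset V)) (A : Finset V) (hA : A.Nonempty) :
    Finpartition (Finset.univ : Finset V) :=
  (P.avoid A).extend hA.ne_empty Finset.sdiff_disjoint
    (Finset.sdiff_union_of_subset (Finset.subset_univ A))

theorem Finpartition.mem_parts_isolate {V : Type*} [Fintype V] [DecidableEq V]
    {P : Finpartition (Finset.univ : Finset V)} {A : Finset V} {hA : A.Nonempty} {R : Finset V} :
    R ∈ (P.isolate A hA).parts ↔ R = A ∨ ∃ Q ∈ P.parts, ¬ Q ⊆ A ∧ Q \ A = R := by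
  simp [Finpartition.isolate, Finpartition.mem_avoid]

/-- If the edges leaving `A` have total weight less than that of some edge inside `A` which no part
of `P` contains, then making `A` a part increases the value. -/
theorem pVal_lt_pVal_isolate {V : Type*} [Fintype V] [DecidableEq V] (G : SimpleGraph V)
    (w : Sym2 V → ℕ) (P : Finpartition (Finset.univ : Finset V)) (A : Finset V)
    (hA : A.Nonempty) (L : Finset (Sym2 V)) (e₀ : Sym2 V) (he₀ : e₀ ∈ G.edgeSet)
    (he₀A : e₀ ∈ A.sym2) (he₀P : ∀ Q ∈ P.parts, e₀ ∉ Q.sym2)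
    (hL : ∀ a ∈ A, ∀ b ∉ A, G.Adj a b → s(a, b) ∈ L) (hw : ∑ e ∈ L, w e < w e₀) :
    pVal G w P < pVal G w (P.isolate A hA) := by
  rw [pVal_eq_sum_filter, pVal_eq_sum_filter]
  set E := Finset.univ.filter fun e : Sym2 V => e ∈ G.edgeSet ∧ ∃ Q ∈ P.parts, e ∈ Q.sym2 with hE
  set E' := Finset.univ.filter fun e : Sym2 V =>
    e ∈ G.edgeSet ∧ ∃ Q ∈ (P.isolate A hA).parts, e ∈ Q.sym2 with hE'
  have hloss : E \ E' ⊆ L := by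
    intro e he
    induction e with
    | _ a b =>
      simp only [hE, hE', Finset.mem_sdiff, Finset.mem_filter, Finset.mem_univ, true_and,
        Finset.mk_mem_sym2_iff, SimpleGraph.mem_edgeSet, not_and, not_exists] at he
      obtain ⟨⟨hab, Q, hQ, haQ, hbQ⟩, hnot⟩ := he
      by_cases ha : a ∈ A <;> by_cases hb : b ∈ A
      · exact absurd hb (hnot hab A (Finpartition.mem_parts_isolate.2 (Or.inl rfl)) ha)
      · exact hL a ha b hb hab
      · rw [Sym2.eq_swap]
        exact hL b hb a ha hab.symm
      · refine absurd (Finset.mem_sdiff.2 ⟨hbQ, hb⟩) (hnot hab (Q \ A)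
          (Finpartition.mem_parts_isolate.2 (Or.inr ⟨Q, hQ, fun h => ha (h haQ), rfl⟩))
          (Finset.mem_sdiff.2 ⟨haQ, ha⟩))
  have hgain : e₀ ∈ E' \ E := by
    simp only [hE, hE', Finset.mem_sdiff, Finset.mem_filter, Finset.mem_univ, true_and, not_and,
      not_exists]
    exact ⟨⟨he₀, A, Finpartition.mem_parts_isolate.2 (Or.inl rfl), he₀A⟩, fun _ => he₀P⟩
  calc ∑ e ∈ E, w e = ∑ e ∈ E ∩ E', w e + ∑ e ∈ E \ E', w e :=
        (Finset.sum_inter_add_sum_sdiff E E' w).symm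
    _ ≤ ∑ e ∈ E ∩ E', w e + ∑ e ∈ L, w e := by
        gcongr
    _ < ∑ e ∈ E ∩ E', w e + w e₀ := by
        gcongr
    _ ≤ ∑ e ∈ E' ∩ E, w e + ∑ e ∈ E' \ E, w e := by
        rw [Finset.inter_comm]
        gcongr
        exact Finset.single_le_sum (f := w) (fun _ _ => Nat.zero_le _) hgain
    _ = ∑ e ∈ E', w e := Finset.sum_inter_add_sum_sdiff E' E w

theorem two_mul_add_two_le_cap {k m : ℕ} (hk : 2 ≤ k) : 2 * m + 2 ≤ cap k m := by
  have h₁ : 1 ≤ k * (k - 1) / 2 := by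
    rw [Nat.le_div_iff_mul_le two_pos]
    exact (Nat.mul_le_mul hk (by omega : 1 ≤ k - 1)).trans' (by norm_num)
  have h₂ : 2 * m ≤ k * m := Nat.mul_le_mul_right m hk
  unfold cap
  omega

/-- In every optimal 𝒞-partition of `G`, for each `i` the whole set
`{u_i} ∪ I_i` lies in a single part. -/
theorem stmt16 (k m : ℕ) (hk : 2 ≤ k) (hm : 1 ≤ m)
    (H : SimpleGraph (Fin k × Fin (2 ^ m)))
    (hH : ∀ a b : Fin k × Fin (2 ^ m), H.Adj a b → a.1 ≠ b.1)
    (P : Finpartition (Finset.univ : Finset (MCVtx k m H)))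
    (hP : ∀ Q ∈ P.parts, Q.card ≤ cap k m)
    (hopt : ∀ P' : Finpartition (Finset.univ : Finset (MCVtx k m H)),
      (∀ Q ∈ P'.parts, Q.card ≤ cap k m) →
        pVal (mcGraph k m H) (mcW k m H) P' ≤ pVal (mcGraph k m H) (mcW k m H) P) :
    ∀ i : Fin k, ∃ Q ∈ P.parts,
      (Sum.inr (Sum.inl i) : MCVtx k m H) ∈ Q ∧
      ∀ z : Fin (cap k m - m - 1),
        (Sum.inr (Sum.inr (Sum.inl (i, z))) : MCVtx k m H) ∈ Q := by
  intro i
  obtain ⟨Q, hQ, hiQ⟩ := P.exists_mem (Finset.mem_univ (Sum.inr (Sum.inl i) : MCVtx k m H))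
  refine ⟨Q, hQ, hiQ, fun z => ?_⟩
  by_contra hz
  have hcap := two_mul_add_two_le_cap (m := m) hk
  set A : Finset (MCVtx k m H) := insert (Sum.inr (Sum.inl i))
    (Finset.univ.image fun y => Sum.inr (Sum.inr (Sum.inl (i, y)))) with hA
  have hAcard : A.card ≤ cap k m := by
    refine (Finset.card_insert_le _ _).trans ?_
    have := Finset.card_image_le (s := Finset.univ)
      (f := fun y => (Sum.inr (Sum.inr (Sum.inl (i, y))) : MCVtx k m H))
    rw [Finset.card_univ, Fintype.card_fin] at this
    omega
  have hAne : A.Nonempty := Finset.insert_nonempty _ _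
  let L : Finset (Sym2 (MCVtx k m H)) := Finset.univ.image fun p : Fin m × Bool =>
    s(Sum.inr (Sum.inl i), Sum.inl (i, p))
  refine (hopt (P.isolate A hAne) ?_).not_gt
    (pVal_lt_pVal_isolate _ _ P A hAne L
      s(Sum.inr (Sum.inl i), Sum.inr (Sum.inr (Sum.inl (i, z)))) ?_ ?_ ?_ ?_ ?_)
  · intro R hR
    obtain rfl | ⟨S, hS, -, rfl⟩ := Finpartition.mem_parts_isolate.1 hR
    · exact hAcard
    · exact (Finset.card_le_card Finset.sdiff_subset).trans (hP S hS)
  · exact Or.inl rfl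
  · simp [hA]
  · intro R hR hmem
    rw [Finset.mk_mem_sym2_iff] at hmem
    exact hz (P.eq_of_mem_parts hQ hR hiQ hmem.1 ▸ hmem.2)
  · intro a ha b hb hab
    simp only [hA, Finset.mem_insert, Finset.mem_image, Finset.mem_univ, true_and] at ha
    obtain rfl | ⟨y, rfl⟩ := ha
    · rcases b with ⟨j, p⟩ | j | ⟨j, y⟩ | e | u <;> simp [mcGraph, mcR] at hab
      · subst hab
        exact Finset.mem_image_of_mem _ (Finset.mem_univ p)
      · subst hab
        simp [hA] at hb
    · rcases b with b | j | y | e | u <;> simp [mcGraph, mcR] at hab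
      subst hab
      simp [hA] at hb
  · calc ∑ e ∈ L, mcW k m H e
        ≤ L.card * (3 * cap k m ^ 2) := by
          rw [← smul_eq_mul]
          refine Finset.sum_le_card_nsmul _ _ _ fun e he => ?_
          obtain ⟨p, -, rfl⟩ := Finset.mem_image.1 he
          exact le_rfl
      _ ≤ (m * 2) * (3 * cap k m ^ 2) := by
          gcongr
          refine Finset.card_image_le.trans ?_
          simp
      _ = (6 * m) * cap k m ^ 2 := by ring
      _ < (4 * cap k m) * cap k m ^ 2 := by
          have : 0 < cap k m := by omega
          gcongr ?_ * _
          omega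
      _ = 4 * cap k m ^ 3 := by ring
end

section
/- In every optimal 𝒞-partition P of the graph G, if a part Q of P contains the vertex u_i for some i ∈ Fin k, then |Q ∩ V^i| = m. -/
open scoped Classical

section PartitionValue

variable {V : Type*} [DecidableEq V] (G : SimpleGraph V) (w : Sym2 V → ℕ)

/-- If every edge weight is covered by the charges of its two orientations, the value of a part
is at most its total charge. -/
lemma partVal_le_sum_charge (g : V → V → ℕ)
    (hg : ∀ a b, G.Adj a b → w s(a, b) ≤ g a b + g b a) (Q : Finset V) :
    partVal G w Q ≤ ∑ a ∈ Q, ∑ b ∈ Q, g a b := by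
  rw [← Finset.sum_product', partVal]
  refine le_trans (Finset.sum_le_sum (g := fun e => ∑ p ∈ (Q ×ˢ Q) with s(p.1, p.2) = e,
    g p.1 p.2) ?_) ?_
  swap
  · exact Finset.sum_fiberwise_le_sum_of_sum_fiber_nonneg (s := Q ×ˢ Q)
      (t := Q.sym2.filter fun e => e ∈ G.edgeSet) (g := fun p => s(p.1, p.2))
      (f := fun p => g p.1 p.2) fun _ _ => Nat.zero_le _
  intro e
  induction e using Sym2.ind with
  | _ a b =>
    intro he
    simp only [Finset.mem_filter, Finset.mk_mem_sym2_iff, SimpleGraph.mem_edgeSet] at he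
    obtain ⟨⟨ha, hb⟩, hab⟩ := he
    have hne : (a, b) ≠ (b, a) := fun h => hab.ne (Prod.mk.inj h).1
    calc w s(a, b) ≤ g a b + g b a := hg a b hab
      _ = ∑ p ∈ ({(a, b), (b, a)} : Finset (V × V)), g p.1 p.2 :=
          (Finset.sum_pair (f := fun p : V × V => g p.1 p.2) hne).symm
      _ ≤ _ := by
          refine Finset.sum_le_sum_of_subset fun p hp => ?_
          simp only [Finset.mem_insert, Finset.mem_singleton] at hp
          rcases hp with rfl | rfl <;> simp [ha, hb]

/-- The value of a part is at least the weight of any star it contains. -/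
lemma sum_star_le_partVal {Q : Finset V} {c : V} (hc : c ∈ Q) {B : Finset V} (hB : B ⊆ Q)
    (hadj : ∀ b ∈ B, G.Adj c b) : ∑ b ∈ B, w s(c, b) ≤ partVal G w Q := by
  have hinj : Set.InjOn (fun b => s(c, b)) (B : Set V) := fun a _ b _ h => by
    simpa only [Sym2.congr_right] using h
  rw [← Finset.sum_image (f := w) hinj, partVal]
  refine Finset.sum_le_sum_of_subset fun e he => ?_
  obtain ⟨b, hb, rfl⟩ := Finset.mem_image.1 he
  simp [hc, hB hb, hadj b hb]

variable [Fintype V] (P : Finpartition (Finset.univ : Finset V))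

lemma pVal_le_sum_charge (g : V → V → ℕ)
    (hg : ∀ a b, G.Adj a b → w s(a, b) ≤ g a b + g b a) :
    pVal G w P ≤ ∑ a, ∑ b ∈ P.part a, g a b := by
  calc pVal G w P ≤ ∑ Q ∈ P.parts, ∑ a ∈ Q, ∑ b ∈ Q, g a b :=
        Finset.sum_le_sum fun Q _ => partVal_le_sum_charge G w g hg Q
    _ = ∑ Q ∈ P.parts, ∑ a ∈ Q, ∑ b ∈ P.part a, g a b :=
        Finset.sum_congr rfl fun Q hQ => Finset.sum_congr rfl fun a ha => by
          rw [P.part_eq_of_mem hQ ha]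
    _ = ∑ a ∈ P.parts.biUnion id, ∑ b ∈ P.part a, g a b :=
        (Finset.sum_biUnion P.disjoint).symm
    _ = _ := by rw [P.biUnion_parts]

lemma sum_partVal_le_pVal {ι : Type*} [Fintype ι] (c : ι → V)
    (hc : Function.Injective fun i => P.part (c i)) :
    ∑ i, partVal G w (P.part (c i)) ≤ pVal G w P := by
  rw [← Finset.sum_image (s := Finset.univ) (g := fun i => P.part (c i)) (f := partVal G w)
    fun _ _ _ _ h => hc h]
  refine Finset.sum_le_sum_of_subset fun Q hQ => ?_
  obtain ⟨i, -, rfl⟩ := Finset.mem_image.1 hQ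
  exact P.part_mem.2 (Finset.mem_univ _)

end PartitionValue

lemma mul_add_two_le_cap {k : ℕ} (m : ℕ) (hk : 2 ≤ k) : k * m + 2 ≤ cap k m := by
  have h : 1 ≤ k * (k - 1) / 2 := by
    rw [Nat.le_div_iff_mul_le two_pos]
    simpa using Nat.mul_le_mul hk (by omega : 1 ≤ k - 1)
  unfold cap
  omega

lemma indep_deficit_absurd {C t N a b : ℕ} (hC : t + 2 ≤ C) (ha : a < N) (hb : b ≤ 2 * t)
    (h : 4 * C ^ 3 * N + 3 * C ^ 2 * t + 2 * C * t ≤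
      4 * C ^ 3 * a + 3 * C ^ 2 * b + (2 * C * (C - 1) + 2 * t * (C - 1))) : False := by
  obtain ⟨d, rfl⟩ := Nat.exists_eq_add_of_le hC
  obtain ⟨N, rfl⟩ := Nat.exists_eq_add_of_lt ha
  have e : t + 2 + d - 1 = t + 1 + d := by omega
  rw [e] at h
  have hb' := Nat.mul_le_mul_left (3 * (t + 2 + d) ^ 2) hb
  have hN : 0 ≤ 4 * (t + 2 + d) ^ 3 * N := Nat.zero_le _
  ring_nf at h hb' hN
  nlinarith [h, hb', hN, Nat.zero_le (t * d), Nat.zero_le (t ^ 2 * d), Nat.zero_le (t * d ^ 2)]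

lemma clique_deficit_absurd {C t N b : ℕ} (hC : t + 2 ≤ C) (hb : b < t)
    (h : 4 * C ^ 3 * N + 3 * C ^ 2 * t + 2 * C * t ≤
      4 * C ^ 3 * N + 3 * C ^ 2 * b + (2 * C * (C - 1) + 2 * t * (C - 1))) : False := by
  have hb' := Nat.mul_le_mul_left (3 * C ^ 2) (show b + 1 ≤ t from hb)
  have h1 := Nat.mul_le_mul_left (2 * C) (Nat.sub_le C 1)
  have h2 := Nat.mul_le_mul_left (2 * t) (Nat.sub_le C 1)
  have hpos : 0 < C ^ 2 := pow_pos (by omega) 2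
  nlinarith

section Construction

variable (k m : ℕ) (H : SimpleGraph (Fin k × Fin (2 ^ m)))

/-- The number of independent-set vertices `I_i`. -/
abbrev indepSize : ℕ := cap k m - m - 1

/-- The vertex `u_i`. -/
abbrev hub (i : Fin k) : MCVtx k m H := Sum.inr (Sum.inl i)

/-- The apex vertex `x`. -/
abbrev apex : MCVtx k m H := Sum.inr (Sum.inr (Sum.inr (Sum.inr ())))

/-- The vertices of `V^i` in `Q`. -/
noncomputable abbrev cliqueIn (Q : Finset (MCVtx k m H)) (i : Fin k) : Finset (MCVtx k m H) :=
  Q.filter fun v => ∃ ℓ : Fin m, ∃ c : Bool, v = (Sum.inl (i, ℓ, c) : MCVtx k m H)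

/-- The vertices of `I_i` in `Q`. -/
noncomputable abbrev indepIn (Q : Finset (MCVtx k m H)) (i : Fin k) : Finset (MCVtx k m H) :=
  Q.filter fun v => ∃ z, v = (Sum.inr (Sum.inr (Sum.inl (i, z))) : MCVtx k m H)

/-- Each edge of `G` is charged to `u_i`, to `x`, or to a vertex of some `V^i`. -/
noncomputable def mcCharge (a b : MCVtx k m H) : ℕ :=
  match a with
  | Sum.inr (Sum.inl i) =>
      (if ∃ z, b = (Sum.inr (Sum.inr (Sum.inl (i, z))) : MCVtx k m H)
        then 4 * cap k m ^ 3 else 0) +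
      (if ∃ ℓ : Fin m, ∃ c : Bool, b = (Sum.inl (i, ℓ, c) : MCVtx k m H)
        then 3 * cap k m ^ 2 else 0)
  | Sum.inr (Sum.inr (Sum.inr (Sum.inr _))) => if b = apex k m H then 0 else 2 * cap k m
  | Sum.inl v => if b = (Sum.inl v : MCVtx k m H) then 0 else 1
  | _ => 0

lemma mcW_le_mcCharge (a b : MCVtx k m H) (h : (mcGraph k m H).Adj a b) :
    mcW k m H s(a, b) ≤ mcCharge k m H a b + mcCharge k m H b a := by
  have hC : 1 ≤ cap k m := by unfold cap; omega
  rcases a with ⟨i, l, c⟩ | i | ⟨i, z⟩ | e | u <;>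
  rcases b with ⟨j, l', c'⟩ | j | ⟨j, z'⟩ | f | v <;>
  simp only [mcGraph, mcR, or_self, or_false, false_or, or_true] at h <;>
  simp only [mcW, mcD, mcCharge, Sym2.lift_mk, Sum.inl.injEq, Sum.inr.injEq, reduceCtorEq,
    exists_false, if_false, add_zero, zero_add]
  · rw [if_neg (by aesop)]
    omega
  · rw [if_pos ⟨l, c, by rw [h]⟩]
    omega
  · omega
  · omega
  · rw [if_pos ⟨l', c', by rw [h]⟩]
    omega
  · rw [if_pos ⟨z', by rw [h]⟩]
  · rw [if_pos ⟨z, by rw [h]⟩]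
  all_goals omega

variable (P : Finpartition (Finset.univ : Finset (MCVtx k m H)))

lemma pVal_mcGraph_le (hP : ∀ Q ∈ P.parts, Q.card ≤ cap k m) :
    pVal (mcGraph k m H) (mcW k m H) P ≤
      4 * cap k m ^ 3 * ∑ i, (indepIn k m H (P.part (hub k m H i)) i).card +
      3 * cap k m ^ 2 * ∑ i, (cliqueIn k m H (P.part (hub k m H i)) i).card +
      (2 * cap k m * (cap k m - 1) + 2 * (k * m) * (cap k m - 1)) := by
  have hcard (a : MCVtx k m H) : (P.part a \ {a}).card ≤ cap k m - 1 := by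
    have h1 : a ∈ P.part a := P.mem_part (Finset.mem_univ a)
    rw [Finset.card_sdiff_of_subset (Finset.singleton_subset_iff.2 h1), Finset.card_singleton]
    exact Nat.sub_le_sub_right (hP _ (P.part_mem.2 (Finset.mem_univ a))) 1
  have hstar (a : MCVtx k m H) (r : ℕ) :
      ∑ b ∈ P.part a, (if b = a then 0 else r) ≤ r * (cap k m - 1) := by
    simp only [← ite_not (p := _ = a), ← Finset.sum_filter, Finset.sum_const, smul_eq_mul]
    rw [mul_comm, Finset.filter_ne', ← Finset.sdiff_singleton_eq_erase]
    exact Nat.mul_le_mul_left _ (hcard a)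
  have hhub (i : Fin k) : ∑ b ∈ P.part (hub k m H i), mcCharge k m H (hub k m H i) b =
      4 * cap k m ^ 3 * (indepIn k m H (P.part (hub k m H i)) i).card +
      3 * cap k m ^ 2 * (cliqueIn k m H (P.part (hub k m H i)) i).card := by
    simp only [mcCharge, Finset.sum_add_distrib, ← Finset.sum_filter, Finset.sum_const,
      smul_eq_mul]
    ring
  have hclique : ∑ v : Fin k × Fin m × Bool,
      ∑ b ∈ P.part (Sum.inl v), mcCharge k m H (Sum.inl v) b ≤
        2 * (k * m) * (cap k m - 1) := by
    refine (Finset.sum_le_sum fun v _ => hstar (Sum.inl v) 1).trans (le_of_eq ?_)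
    simp only [Finset.sum_const, Finset.card_univ, Fintype.card_prod, Fintype.card_fin,
      Fintype.card_bool, smul_eq_mul]
    ring
  refine (pVal_le_sum_charge _ _ P _ (mcW_le_mcCharge k m H)).trans ?_
  simp only [Fintype.sum_sum_type, hhub, Finset.sum_add_distrib, ← Finset.mul_sum]
  have hapex := hstar (apex k m H) (2 * cap k m)
  have hrest : ∑ z, ∑ b ∈ P.part (Sum.inr (Sum.inr (Sum.inl z))),
      mcCharge k m H (Sum.inr (Sum.inr (Sum.inl z))) b = 0 := by
    simp only [mcCharge, Finset.sum_const_zero]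
  have hrest' : ∑ e, ∑ b ∈ P.part (Sum.inr (Sum.inr (Sum.inr (Sum.inl e)))),
      mcCharge k m H (Sum.inr (Sum.inr (Sum.inr (Sum.inl e)))) b = 0 := by
    simp only [mcCharge, Finset.sum_const_zero]
  have hx : ∑ u, ∑ b ∈ P.part (Sum.inr (Sum.inr (Sum.inr (Sum.inr u)))),
      mcCharge k m H (Sum.inr (Sum.inr (Sum.inr (Sum.inr u)))) b ≤
        2 * cap k m * (cap k m - 1) := by
    rw [Fintype.sum_unique]
    exact hapex
  rw [hrest, hrest']
  omega

lemma card_indepIn_le (Q : Finset (MCVtx k m H)) (i : Fin k) :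
    (indepIn k m H Q i).card ≤ indepSize k m := by
  have hsub : indepIn k m H Q i ⊆ Finset.univ.image
      fun z : Fin (indepSize k m) => (Sum.inr (Sum.inr (Sum.inl (i, z))) : MCVtx k m H) := by
    intro v hv
    obtain ⟨-, z, rfl⟩ := Finset.mem_filter.1 hv
    exact Finset.mem_image_of_mem _ (Finset.mem_univ z)
  simpa using (Finset.card_le_card hsub).trans Finset.card_image_le

lemma card_cliqueIn_le (Q : Finset (MCVtx k m H)) (i : Fin k) :
    (cliqueIn k m H Q i).card ≤ 2 * m := by
  have hsub : cliqueIn k m H Q i ⊆ Finset.univ.image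
      fun p : Fin m × Bool => (Sum.inl (i, p) : MCVtx k m H) := by
    intro v hv
    obtain ⟨-, l, c, rfl⟩ := Finset.mem_filter.1 hv
    exact Finset.mem_image_of_mem _ (Finset.mem_univ (l, c))
  simpa [mul_comm] using (Finset.card_le_card hsub).trans Finset.card_image_le

lemma card_indepIn_add_card_cliqueIn_lt {Q : Finset (MCVtx k m H)} {i : Fin k}
    (hi : hub k m H i ∈ Q) :
    (indepIn k m H Q i).card + (cliqueIn k m H Q i).card < Q.card := by
  have hdisj : Disjoint (indepIn k m H Q i) (cliqueIn k m H Q i) := by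
    refine Finset.disjoint_left.2 fun v hv hv' => ?_
    obtain ⟨-, z, rfl⟩ := Finset.mem_filter.1 hv
    obtain ⟨-, l, c, h⟩ := Finset.mem_filter.1 hv'
    simp at h
  rw [← Finset.card_union_of_disjoint hdisj]
  refine Finset.card_lt_card ((Finset.ssubset_iff_of_subset ?_).2 ⟨_, hi, ?_⟩)
  · exact Finset.union_subset (Finset.filter_subset _ _) (Finset.filter_subset _ _)
  · simp

/-- The colours of the reference partition: `{u_i} ∪ I_i ∪ {u^i_ℓ : ℓ}` for each `i`, the set
`{x} ∪ {v^i_ℓ : i, ℓ}`, and the singletons `{v_e}`. -/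
def refColor : MCVtx k m H → Fin k ⊕ {e : Sym2 (Fin k × Fin (2 ^ m)) // e ∈ H.edgeSet} ⊕ Unit
  | Sum.inl (i, _, false) => Sum.inl i
  | Sum.inl (_, _, true) => Sum.inr (Sum.inr ())
  | Sum.inr (Sum.inl i) => Sum.inl i
  | Sum.inr (Sum.inr (Sum.inl z)) => Sum.inl z.1
  | Sum.inr (Sum.inr (Sum.inr (Sum.inl e))) => Sum.inr (Sum.inl e)
  | Sum.inr (Sum.inr (Sum.inr (Sum.inr _))) => Sum.inr (Sum.inr ())

/-- The partition of the vertices into the colour classes of `refColor`. -/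
noncomputable def refPartition : Finpartition (Finset.univ : Finset (MCVtx k m H)) :=
  Finpartition.ofSetoid (Setoid.ker (refColor k m H))

lemma mem_part_refPartition {a b : MCVtx k m H} :
    b ∈ (refPartition k m H).part a ↔ refColor k m H a = refColor k m H b :=
  Finpartition.mem_part_ofSetoid_iff_rel

lemma card_le_cap_of_mem_refPartition (hk : 2 ≤ k) {Q : Finset (MCVtx k m H)}
    (hQ : Q ∈ (refPartition k m H).parts) : Q.card ≤ cap k m := by
  have hcap := mul_add_two_le_cap m hk
  have hmk : m ≤ k * m := Nat.le_mul_of_pos_left m (by omega)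
  obtain ⟨a, ha⟩ := (refPartition k m H).nonempty_of_mem_parts hQ
  have hmem (b : MCVtx k m H) (hb : b ∈ Q) : refColor k m H b = refColor k m H a := by
    rw [← (refPartition k m H).part_eq_of_mem hQ ha, mem_part_refPartition] at hb
    exact hb.symm
  rcases hcol : refColor k m H a with i | e | u
  · have hsub : Q ⊆ Finset.univ.image (Sum.elim
        (fun l : Fin m => (Sum.inl (i, l, false) : MCVtx k m H))
        (Sum.elim (fun _ : Unit => hub k m H i)
          (fun z : Fin (indepSize k m) => Sum.inr (Sum.inr (Sum.inl (i, z)))))) := by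
      intro b hb
      have h := (hmem b hb).trans hcol
      rcases b with ⟨j, l, _ | _⟩ | j | ⟨j, z⟩ | e | u <;>
        simp only [refColor, Sum.inl.injEq, reduceCtorEq] at h <;> subst h
      · exact Finset.mem_image_of_mem _ (Finset.mem_univ (Sum.inl l))
      · exact Finset.mem_image_of_mem _ (Finset.mem_univ (Sum.inr (Sum.inl ())))
      · exact Finset.mem_image_of_mem _ (Finset.mem_univ (Sum.inr (Sum.inr z)))
    have := (Finset.card_le_card hsub).trans Finset.card_image_le
    simp only [Finset.card_univ, Fintype.card_sum, Fintype.card_fin, Fintype.card_unit] at this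
    unfold indepSize at this
    omega
  · have hsub : Q ⊆ {Sum.inr (Sum.inr (Sum.inr (Sum.inl e)))} := by
      intro b hb
      have h := (hmem b hb).trans hcol
      rcases b with ⟨j, l, _ | _⟩ | j | ⟨j, z⟩ | f | u <;>
        simp only [refColor, Sum.inr.injEq, Sum.inl.injEq, reduceCtorEq] at h
      exact Finset.mem_singleton.2 (by rw [h])
    have := Finset.card_le_card hsub
    rw [Finset.card_singleton] at this
    omega
  · have hsub : Q ⊆ Finset.univ.image (Sum.elim
        (fun p : Fin k × Fin m => (Sum.inl (p.1, p.2, true) : MCVtx k m H))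
        (fun _ : Unit => apex k m H)) := by
      intro b hb
      have h := (hmem b hb).trans hcol
      rcases b with ⟨j, l, _ | _⟩ | j | ⟨j, z⟩ | e | u <;>
        simp only [refColor, Sum.inr.injEq, reduceCtorEq] at h
      · exact Finset.mem_image_of_mem _ (Finset.mem_univ (Sum.inl (j, l)))
      · exact Finset.mem_image_of_mem _ (Finset.mem_univ (Sum.inr ()))
    have := (Finset.card_le_card hsub).trans Finset.card_image_le
    simp only [Finset.card_univ, Fintype.card_sum, Fintype.card_prod, Fintype.card_fin,
      Fintype.card_unit] at this
    omega

lemma le_pVal_refPartition :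
    4 * cap k m ^ 3 * (k * indepSize k m) + 3 * cap k m ^ 2 * (k * m) + 2 * cap k m * (k * m) ≤
      pVal (mcGraph k m H) (mcW k m H) (refPartition k m H) := by
  have hself (a : MCVtx k m H) : a ∈ (refPartition k m H).part a :=
    (mem_part_refPartition k m H).2 rfl
  let leaf : Fin k → Fin (indepSize k m) ⊕ Fin m → MCVtx k m H := fun i =>
    Sum.elim (fun z => Sum.inr (Sum.inr (Sum.inl (i, z)))) (fun l => Sum.inl (i, l, false))
  have hleaf (i : Fin k) : Function.Injective (leaf i) := by
    rintro (z | l) (z' | l') h <;> simp [leaf] at h ⊢ <;> exact h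
  have hhub (i : Fin k) : 4 * cap k m ^ 3 * indepSize k m + 3 * cap k m ^ 2 * m ≤
      partVal (mcGraph k m H) (mcW k m H) ((refPartition k m H).part (hub k m H i)) := by
    refine le_trans (le_of_eq ?_) (sum_star_le_partVal _ _ (hself _)
      (B := Finset.univ.image (leaf i)) ?_ ?_)
    · rw [Finset.sum_image fun _ _ _ _ h => hleaf i h]
      simp [leaf, mcW, mcD, mul_comm]
    · intro b hb
      obtain ⟨z | l, -, rfl⟩ := Finset.mem_image.1 hb <;>
        simp [leaf, mem_part_refPartition, refColor]
    · intro b hb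
      obtain ⟨z | l, -, rfl⟩ := Finset.mem_image.1 hb <;> simp [leaf, mcGraph, mcR]
  let ray : Fin k × Fin m → MCVtx k m H := fun p => Sum.inl (p.1, p.2, true)
  have hray : Function.Injective ray := by
    rintro ⟨i, l⟩ ⟨j, l'⟩ h
    simpa [ray] using h
  have hapex : 2 * cap k m * (k * m) ≤
      partVal (mcGraph k m H) (mcW k m H) ((refPartition k m H).part (apex k m H)) := by
    refine le_trans (le_of_eq ?_) (sum_star_le_partVal _ _ (hself _)
      (B := Finset.univ.image ray) ?_ ?_)
    · rw [Finset.sum_image fun _ _ _ _ h => hray h]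
      simp [ray, mcW, mcD, mul_comm]
    · intro b hb
      obtain ⟨p, -, rfl⟩ := Finset.mem_image.1 hb
      simp [ray, mem_part_refPartition, refColor]
    · intro b hb
      obtain ⟨p, -, rfl⟩ := Finset.mem_image.1 hb
      simp [ray, mcGraph, mcR]
  have hinj : Function.Injective fun o : Option (Fin k) =>
      (refPartition k m H).part (o.elim (apex k m H) (hub k m H)) := by
    intro o o' h
    have h' := hself (o'.elim (apex k m H) (hub k m H))
    replace h : (refPartition k m H).part (o.elim (apex k m H) (hub k m H)) =
      (refPartition k m H).part (o'.elim (apex k m H) (hub k m H)) := h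
    rw [← h, mem_part_refPartition] at h'
    rcases o with _ | i <;> rcases o' with _ | j <;> simp_all [refColor]
  have hsum := sum_partVal_le_pVal (mcGraph k m H) (mcW k m H) (refPartition k m H) _ hinj
  rw [Fintype.sum_option] at hsum
  have hhubs := Finset.sum_le_sum fun i (_ : i ∈ Finset.univ) => hhub i
  simp only [Finset.sum_const, Finset.card_univ, Fintype.card_fin, smul_eq_mul] at hhubs
  simp only [Option.elim_none, Option.elim_some] at hsum
  calc _ = 2 * cap k m * (k * m) +
        k * (4 * cap k m ^ 3 * indepSize k m + 3 * cap k m ^ 2 * m) := by ring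
    _ ≤ _ := (Nat.add_le_add hapex hhubs).trans hsum

end Construction

/-- In every optimal 𝒞-partition of `G`, a part containing `u_i` contains
exactly `m` vertices of `V^i`. -/
theorem stmt17 (k m : ℕ) (hk : 2 ≤ k) (hm : 1 ≤ m)
    (H : SimpleGraph (Fin k × Fin (2 ^ m)))
    (hH : ∀ a b : Fin k × Fin (2 ^ m), H.Adj a b → a.1 ≠ b.1)
    (P : Finpartition (Finset.univ : Finset (MCVtx k m H)))
    (hP : ∀ Q ∈ P.parts, Q.card ≤ cap k m)
    (hopt : ∀ P' : Finpartition (Finset.univ : Finset (MCVtx k m H)),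
      (∀ Q ∈ P'.parts, Q.card ≤ cap k m) →
        pVal (mcGraph k m H) (mcW k m H) P' ≤ pVal (mcGraph k m H) (mcW k m H) P) :
    ∀ Q ∈ P.parts, ∀ i : Fin k, (Sum.inr (Sum.inl i) : MCVtx k m H) ∈ Q →
      (Q.filter (fun v => ∃ ℓ : Fin m, ∃ c : Bool,
        v = (Sum.inl (i, ℓ, c) : MCVtx k m H))).card = m := by
  intro Q hQ i hi
  have hle := (le_pVal_refPartition k m H).trans <|
    (hopt _ fun Q hQ => card_le_cap_of_mem_refPartition k m H hk hQ).trans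
      (pVal_mcGraph_le k m H P hP)
  have hC := mul_add_two_le_cap m hk
  have hmk : m ≤ k * m := Nat.le_mul_of_pos_left m (by omega)
  have hself (j : Fin k) : hub k m H j ∈ P.part (hub k m H j) := P.mem_part (Finset.mem_univ _)
  have hroom (j : Fin k) := (card_indepIn_add_card_cliqueIn_lt k m H (hself j)).trans_le
    (hP _ (P.part_mem.2 (Finset.mem_univ _)))
  have hindep (j : Fin k) := card_indepIn_le k m H (P.part (hub k m H j)) j
  have hclique (j : Fin k) := card_cliqueIn_le k m H (P.part (hub k m H j)) j
  have hfull (j : Fin k) :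
      (indepIn k m H (P.part (hub k m H j)) j).card = indepSize k m := by
    by_contra hne
    have h1 := Finset.sum_lt_sum (fun j (_ : j ∈ Finset.univ) => hindep j)
      ⟨j, Finset.mem_univ j, lt_of_le_of_ne (hindep j) hne⟩
    have h2 := Finset.sum_le_sum fun j (_ : j ∈ Finset.univ) => hclique j
    simp only [Finset.sum_const, Finset.card_univ, Fintype.card_fin, smul_eq_mul] at h1 h2
    exact indep_deficit_absurd hC h1 (by linarith) hle
  have hle_m (j : Fin k) : (cliqueIn k m H (P.part (hub k m H j)) j).card ≤ m := by
    have := hroom j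
    have := hfull j
    unfold indepSize at *
    omega
  rw [← P.part_eq_of_mem hQ hi]
  by_contra hne
  have h1 := Finset.sum_lt_sum (fun j (_ : j ∈ Finset.univ) => hle_m j)
    ⟨i, Finset.mem_univ i, lt_of_le_of_ne (hle_m i) hne⟩
  simp only [hfull, Finset.sum_const, Finset.card_univ, Fintype.card_fin, smul_eq_mul] at h1 hle
  exact clique_deficit_absurd hC h1 hle
end
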